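/- arXiv:1610.07478 — 3 statements merged into one kernel-verified Lean document; each statement's English description precedes it below -/
import Mathlib

section
/- Let d be an odd positive integer and let E be the edge set of an ε-pseudorandom d-uniform hypergraph on n vertices in which every vertex has degree exactly K, with each hyperedge identified with its weight-d indicator vector in F_2^n. Let C = span(E) ⊆ F_2^n and let B_i be the number of words of C of Hamming weight i. Then for every integer i with n·ε^{1/(2d)} ≤ i ≤ n·(1 − ε^{1/(2d)}), one has B_i/|C| ≤ n · 2^{2ε^{1/2}·|n/2 − i|} · C(n,i) · 2^{−n}. -/
open Finset

/-- Binary entropy function (base-2 logarithm), with `H 0 = H 1 = 0`. -/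
noncomputable def H (p : ℝ) : ℝ := -p * Real.logb 2 p - (1 - p) * Real.logb 2 (1 - p)

/-- Generalized binomial coefficient `C(x, l) = x (x-1) ⋯ (x-l+1) / l!` for real `x`. -/
noncomputable def genChoose (x : ℝ) (l : ℕ) : ℝ :=
  (∏ i ∈ Finset.range l, (x - i)) / (Nat.factorial l : ℝ)

/-- The `m`-th Kravchuk polynomial (with respect to `n`), evaluated at a real `x`. -/
noncomputable def krav (n m : ℕ) (x : ℝ) : ℝ :=
  ∑ l ∈ Finset.range (m + 1), (-1 : ℝ) ^ l * genChoose x l * genChoose ((n : ℝ) - x) (m - l)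

/-- Indicator vector in `F_2^n` of a set of coordinates. -/
def indic {n : ℕ} (e : Finset (Fin n)) : Fin n → ZMod 2 := fun i => if i ∈ e then 1 else 0

/-- `ε`-pseudorandomness of a `d`-uniform hypergraph on `n` vertices with hyperedge set `E`. -/
def epsPR (n d : ℕ) (E : Finset (Finset (Fin n))) (ε : ℝ) : Prop :=
  ∀ S : Finset (Fin n), ∀ j : ℕ, j ≤ d →
    |((E.filter fun e => (e ∩ S).card = j).card : ℝ) / (E.card : ℝ) -
        (Nat.choose d j : ℝ) * ((S.card : ℝ) / (n : ℝ)) ^ j *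
          (1 - (S.card : ℝ) / (n : ℝ)) ^ (d - j)| < ε

/-- The dual of a set of words in `F_2^n`. -/
def dualSet {n : ℕ} (C : Set (Fin n → ZMod 2)) : Set (Fin n → ZMod 2) :=
  {x | ∀ c ∈ C, ∑ i, c i * x i = 0}

/-- The weight enumerator: number of words of `C` of Hamming weight `k`. -/
noncomputable def wtEnum {n : ℕ} (C : Set (Fin n → ZMod 2)) (k : ℕ) : ℕ :=
  Set.ncard {x ∈ C | hammingNorm x = k}

/-- A subspace `C ⊆ F_2^n` is `(ζ, η)`-weakly-binomial. -/
def weaklyBinomial (n : ℕ) (C : Set (Fin n → ZMod 2)) (ζ η : ℝ) : Prop :=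
  ∀ k ≤ n, (wtEnum C k : ℝ) ≤
    (2 : ℝ) ^ (ζ * n) * (Nat.choose n k : ℝ) / (Set.ncard (dualSet C) : ℝ) + (2 : ℝ) ^ (η * n)

/-- Minimal distance of the CSS code with codes `CX`, `CZ`. -/
noncomputable def dmin {n : ℕ} (CX CZ : Set (Fin n → ZMod 2)) : ℕ :=
  sInf {k | ∃ w, ((w ∈ dualSet CX ∧ w ∉ CZ) ∨ (w ∈ dualSet CZ ∧ w ∉ CX)) ∧ hammingNorm w = k}

lemma aux_step (i k j : ℕ) (hj : j < i + k) :
    (Nat.choose (i+k) (j+1) * i^(j+1) * k^(i+k-(j+1))) * ((j+1) * k) =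
    (Nat.choose (i+k) j * i^j * k^(i+k-j)) * ((i+k-j) * i) := by
  have h := Nat.choose_succ_right_eq (i+k) j
  obtain ⟨m, hm⟩ : ∃ m, i + k - j = m + 1 := ⟨i+k-j-1, by omega⟩
  have hm' : i + k - (j+1) = m := by omega
  rw [hm] at h ⊢
  rw [hm', pow_succ, pow_succ k]
  linear_combination (i^j * i * k^m * k) * h

lemma aux_max (i k j : ℕ) (hi : 0 < i) (hk : 0 < k) (hj : j ≤ i + k) :
    Nat.choose (i+k) j * i^j * k^(i+k-j) ≤ Nat.choose (i+k) i * i^i * k^k := by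
  have hkk : i + k - i = k := by omega
  rcases le_total j i with h | h
  · suffices H : ∀ m, m ≤ i → Nat.choose (i+k) (i-m) * i^(i-m) * k^(i+k-(i-m)) ≤
        Nat.choose (i+k) i * i^i * k^k by
      have := H (i-j) (by omega)
      rwa [show i - (i-j) = j by omega] at this
    intro m
    induction m with
    | zero => intro _; simp
    | succ m ih =>
      intro hm
      refine le_trans ?_ (ih (by omega))
      have hs := aux_step i k (i-(m+1)) (by omega)
      rw [show i - (m+1) + 1 = i - m by omega] at hs
      have hle : (i - m) * k ≤ (i + k - (i - (m+1))) * i := by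
        rw [show i + k - (i-(m+1)) = k + (m+1) by omega]
        have : i - m ≤ i := by omega
        nlinarith
      have hpos : 0 < (i - m) * k := Nat.mul_pos (by omega) hk
      by_contra hcon
      push Not at hcon
      have := Nat.mul_lt_mul_of_lt_of_le hcon hle (lt_of_lt_of_le hpos hle)
      rw [hs] at this
      exact absurd this (lt_irrefl _)
  · induction j, h using Nat.le_induction with
    | base => rw [hkk]
    | succ j hij ih =>
      refine le_trans ?_ (ih (by omega))
      have hs := aux_step i k j (by omega)
      have hle : (i + k - j) * i ≤ (j+1) * k := by
        have : i + k - j ≤ k := by omega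
        nlinarith
      by_contra hcon
      push Not at hcon
      have hpos : 0 < (i+k-j) * i := Nat.mul_pos (by omega) hi
      have := Nat.mul_lt_mul_of_lt_of_le hcon hle (lt_of_lt_of_le hpos hle)
      rw [← hs] at this
      exact absurd this (lt_irrefl _)

lemma aux_binmax (i k : ℕ) (hi : 0 < i) (hk : 0 < k) :
    (i+k)^(i+k) ≤ (i+k) * (Nat.choose (i+k) i * i^i * k^k) := by
  set M := Nat.choose (i+k) i * i^i * k^k with hM
  obtain ⟨N, hN⟩ : ∃ N, i + k = N + 1 := ⟨i+k-1, by omega⟩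
  have h0 : i^(N+1) + k^(N+1) ≤ M := by
    rcases le_total i k with h | h
    · have h1 := aux_max i k 1 hi hk (by omega)
      rw [hN, Nat.choose_one_right, pow_one, Nat.add_sub_cancel, ← hN] at h1
      refine le_trans ?_ h1
      have : i^N ≤ k^N := Nat.pow_le_pow_left h N
      calc i^(N+1) + k^(N+1) ≤ i * k^N + k * k^N := by
            rw [pow_succ, pow_succ]; nlinarith
        _ = (i+k) * 1 * k^N := by ring
        _ ≤ (i+k) * i * k^N := by gcongr; omega
    · have h1 := aux_max i k N hi hk (by omega)
      rw [hN, Nat.choose_succ_self_right, Nat.add_sub_cancel_left, pow_one, ← hN] at h1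
      refine le_trans ?_ h1
      have : k^N ≤ i^N := Nat.pow_le_pow_left h N
      calc i^(N+1) + k^(N+1) ≤ i * i^N + k * i^N := by
            rw [pow_succ, pow_succ]; nlinarith
        _ = (i+k) * i^N * 1 := by ring
        _ ≤ (i+k) * i^N * k := by gcongr; omega
  have h1 := add_pow i k (i+k)
  rw [h1, hN, Finset.sum_range_succ, Finset.sum_range_succ']
  have h2 : ∑ j ∈ Finset.range N, i^(j+1) * k^(N+1-(j+1)) * (Nat.choose (N+1) (j+1)) ≤ N * M := by
    calc _ ≤ ∑ j ∈ Finset.range N, M := by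
          refine Finset.sum_le_sum fun j hj => ?_
          have hj' := Finset.mem_range.1 hj
          have := aux_max i k (j+1) hi hk (by omega)
          rw [hN] at this
          calc _ = _ := by ring
            _ ≤ _ := this
            _ = M := by rw [hM, hN]
      _ = N * M := by simp
  simp only [pow_zero, Nat.sub_zero, Nat.sub_self, Nat.choose_zero_right, Nat.choose_self]
  nlinarith

/-- sign character on F_2 -/
def sgn2 (z : ZMod 2) : ℝ := if z = 0 then 1 else -1

lemma sgn2_add (a b : ZMod 2) : sgn2 (a + b) = sgn2 a * sgn2 b := by
  have : ∀ a : ZMod 2, a = 0 ∨ a = 1 := by decide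
  have h11 : (1 : ZMod 2) + 1 = 0 := by decide
  rcases this a with rfl | rfl <;> rcases this b with rfl | rfl <;> simp [sgn2, h11]

def chi2 {n : ℕ} (S : Finset (Fin n)) (x : Fin n → ZMod 2) : ℝ := ∏ v ∈ S, sgn2 (x v)

lemma chi2_add {n : ℕ} (S : Finset (Fin n)) (x y : Fin n → ZMod 2) :
    chi2 S (x + y) = chi2 S x * chi2 S y := by
  simp [chi2, sgn2_add, Finset.prod_mul_distrib]

lemma chi2_abs {n : ℕ} (S : Finset (Fin n)) (x : Fin n → ZMod 2) : |chi2 S x| = 1 := by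
  rw [chi2, Finset.abs_prod]
  refine Finset.prod_eq_one fun v _ => ?_
  unfold sgn2; split_ifs <;> simp

lemma chi2_indic {n : ℕ} (S e : Finset (Fin n)) : chi2 S (indic e) = (-1)^(e ∩ S).card := by
  have : ∀ v, sgn2 (indic e v) = if v ∈ e then -1 else 1 := by
    intro v; unfold sgn2 indic; split_ifs <;> simp_all
  simp only [chi2, this]
  rw [Finset.prod_ite]
  simp only [Finset.prod_const, one_pow, mul_one]
  congr 2
  ext v; simp [and_comm]

noncomputable def dual2 {n : ℕ} (E : Finset (Finset (Fin n))) : Finset (Finset (Fin n)) :=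
  Finset.univ.filter fun S => ∀ e ∈ E, Even (e ∩ S).card

lemma dual2_symm {n : ℕ} (E : Finset (Finset (Fin n))) (S T : Finset (Fin n))
    (hS : S ∈ dual2 E) (hT : T ∈ dual2 E) : symmDiff S T ∈ dual2 E := by
  simp only [dual2, Finset.mem_filter, Finset.mem_univ, true_and] at *
  intro e he
  have h1 := hS e he
  have h2 := hT e he
  have key : (e ∩ symmDiff S T).card + 2 * (e ∩ S ∩ T).card = (e ∩ S).card + (e ∩ T).card := by
    have a1 : (e ∩ S).card = (e ∩ S ∩ T).card + ((e ∩ S) \ T).card := by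
      rw [Finset.card_inter_add_card_sdiff]
    have a2 : (e ∩ T).card = (e ∩ S ∩ T).card + ((e ∩ T) \ S).card := by
      rw [← Finset.card_inter_add_card_sdiff (e ∩ T) S, Finset.inter_right_comm]
    have a3 : (e ∩ symmDiff S T).card = ((e ∩ S) \ T).card + ((e ∩ T) \ S).card := by
      rw [← Finset.card_union_of_disjoint]
      · congr 1; ext v; simp [Finset.mem_symmDiff]; tauto
      · rw [Finset.disjoint_left]; intro v; simp; tauto
    omega
  have : Even ((e ∩ symmDiff S T).card + 2 * (e ∩ S ∩ T).card) := key ▸ h1.add h2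
  rw [Nat.even_add] at this
  exact this.2 (even_two_mul _)

lemma dual2_sum {n : ℕ} (E : Finset (Finset (Fin n))) (t : ℝ) (ht0 : 0 ≤ t) (ht1 : t ≤ 1) :
    ∃ Y ∈ dual2 E, ∑ S ∈ dual2 E, t ^ S.card ≤ (1 + t) ^ Y.card := by
  classical
  let F : Finset (Finset (Fin n)) := Finset.univ.filter fun I => (dual2 E).Shatters I
  have h0 : (∅ : Finset (Fin n)) ∈ dual2 E := by simp [dual2]
  have hF : F.Nonempty := ⟨∅, by
    simp only [F, Finset.mem_filter, Finset.mem_univ, true_and]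
    intro t ht
    exact ⟨∅, h0, by simp [Finset.subset_empty.1 ht]⟩⟩
  obtain ⟨I, hI, hmax⟩ := Finset.exists_max_image F Finset.card hF
  have hIs : (dual2 E).Shatters I := by simpa [F] using hI
  obtain ⟨Y, hY, hIY⟩ := hIs (Finset.Subset.refl I)
  refine ⟨Y, hY, ?_⟩
  have hcard : I.card ≤ Y.card := Finset.card_le_card (Finset.inter_eq_left.1 hIY)
  have hzero : ∀ S ∈ dual2 E, I ∩ S = ∅ → S = ∅ := by
    intro S hS hIS
    by_contra hne
    obtain ⟨v, hv⟩ := Finset.nonempty_iff_ne_empty.2 hne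
    have hvI : v ∉ I := fun h => by
      have : v ∈ I ∩ S := Finset.mem_inter.2 ⟨h, hv⟩
      rw [hIS] at this; simp at this
    have hmem : insert v I ∈ F := by
      simp only [F, Finset.mem_filter, Finset.mem_univ, true_and]
      intro T hT
      obtain ⟨Z, hZ, hIZ⟩ := hIs (t := I ∩ T) Finset.inter_subset_left
      have hnot : ∀ w ∈ I, w ∉ S := fun w hw hws => by
        have : w ∈ I ∩ S := Finset.mem_inter.2 ⟨hw, hws⟩
        rw [hIS] at this; simp at this
      have hiz : ∀ w ∈ I, (w ∈ Z ↔ w ∈ T) := fun w hw => by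
        have := Finset.ext_iff.1 hIZ w
        simpa [hw] using this
      by_cases hc : (v ∈ Z ↔ v ∈ T)
      · refine ⟨Z, hZ, ?_⟩
        ext w
        have hTw := @hT w
        simp only [Finset.mem_inter, Finset.mem_insert] at hTw ⊢
        constructor
        · rintro ⟨rfl | hw, h2⟩
          · exact hc.1 h2
          · exact (hiz w hw).1 h2
        · intro hw
          rcases hTw hw with rfl | h
          · exact ⟨Or.inl rfl, hc.2 hw⟩
          · exact ⟨Or.inr h, (hiz w h).2 hw⟩
      · refine ⟨symmDiff Z S, dual2_symm E Z S hZ hS, ?_⟩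
        ext w
        have hTw := @hT w
        simp only [Finset.mem_inter, Finset.mem_insert, Finset.mem_symmDiff] at hTw ⊢
        constructor
        · rintro ⟨rfl | hw, h2⟩
          · tauto
          · have := hiz w hw; have := hnot w hw; tauto
        · intro hw
          rcases hTw hw with rfl | h
          · tauto
          · have := hiz w h; have := hnot w h; tauto
    have := hmax _ hmem
    rw [Finset.card_insert_of_notMem hvI] at this
    omega
  have hinj : Set.InjOn (fun S => I ∩ S) (dual2 E : Set (Finset (Fin n))) := by
    intro S hS T hT hST
    have hST : I ∩ S = I ∩ T := hST
    have := hzero _ (dual2_symm E S T hS hT) (by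
      ext w
      have := Finset.ext_iff.1 hST w
      simp only [Finset.mem_inter, Finset.mem_symmDiff, Finset.notMem_empty, iff_false] at this ⊢
      tauto)
    exact symmDiff_eq_bot.1 this
  calc ∑ S ∈ dual2 E, t ^ S.card ≤ ∑ S ∈ dual2 E, t ^ (I ∩ S).card :=
        Finset.sum_le_sum fun S _ => pow_le_pow_of_le_one ht0 ht1
          (Finset.card_le_card Finset.inter_subset_right)
    _ = ∑ T ∈ (dual2 E).image (fun S => I ∩ S), t ^ T.card :=
        (Finset.sum_image (f := fun T : Finset (Fin n) => t ^ T.card) hinj).symm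
    _ ≤ ∑ T ∈ I.powerset, t ^ T.card := by
        refine Finset.sum_le_sum_of_subset_of_nonneg ?_ fun _ _ _ => pow_nonneg ht0 _
        intro T hT
        obtain ⟨S, _, rfl⟩ := Finset.mem_image.1 hT
        exact Finset.mem_powerset.2 Finset.inter_subset_left
    _ = (1 + t) ^ I.card := by
        have := Finset.prod_one_add (f := fun _ : Fin n => t) I
        simp only [Finset.prod_const] at this
        exact this.symm
    _ ≤ (1 + t) ^ Y.card := pow_le_pow_right₀ (by linarith) hcard

lemma char_sum {n : ℕ} (E : Finset (Finset (Fin n))) (S : Finset (Fin n))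
    (C : Finset (Fin n → ZMod 2))
    (hC : ∀ x, x ∈ C ↔ x ∈ Submodule.span (ZMod 2) (indic '' (E : Set (Finset (Fin n)))))
    (hS : S ∉ dual2 E) : ∑ x ∈ C, chi2 S x = 0 := by
  simp only [dual2, Finset.mem_filter, Finset.mem_univ, true_and, not_forall] at hS
  obtain ⟨e, he, hodd⟩ := hS
  have hchi : chi2 S (indic e) = -1 := by
    rw [chi2_indic, Odd.neg_one_pow (Nat.not_even_iff_odd.1 hodd)]
  have hmem : indic e ∈ Submodule.span (ZMod 2) (indic '' (E : Set (Finset (Fin n)))) :=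
    Submodule.subset_span ⟨e, he, rfl⟩
  have h : ∑ x ∈ C, chi2 S x = ∑ x ∈ C, chi2 S (x + indic e) := by
    symm
    refine Finset.sum_bij (fun x _ => x + indic e) ?_ ?_ ?_ ?_
    · intro x hx; rw [hC] at hx ⊢; exact Submodule.add_mem _ hx hmem
    · intro x _ y _ h; exact add_right_cancel h
    · intro y hy
      refine ⟨y - indic e, ?_, by simp⟩
      rw [hC] at hy ⊢; exact Submodule.sub_mem _ hy hmem
    · intro _ _; rfl
  simp only [chi2_add, hchi, mul_neg, mul_one, Finset.sum_neg_distrib] at h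
  linarith

lemma macw {n : ℕ} (E : Finset (Finset (Fin n))) (p : ℝ) 
    (C : Finset (Fin n → ZMod 2))
    (hC : ∀ x, x ∈ C ↔ x ∈ Submodule.span (ZMod 2) (indic '' (E : Set (Finset (Fin n))))) :
    2 ^ n * ∑ x ∈ C, p ^ (hammingNorm x) * (1 - p) ^ (n - hammingNorm x) ≤
      C.card * ∑ S ∈ dual2 E, |1 - 2 * p| ^ S.card := by
  have h1 : ∀ x : Fin n → ZMod 2, 2 ^ n * (p ^ (hammingNorm x) * (1 - p) ^ (n - hammingNorm x)) =
      ∑ S : Finset (Fin n), (1 - 2 * p) ^ S.card * chi2 S x := by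
    intro x
    have a := Finset.prod_one_add (f := fun v : Fin n => (1 - 2 * p) * sgn2 (x v)) Finset.univ
    simp only [Finset.prod_mul_distrib, Finset.prod_const, Finset.powerset_univ] at a
    unfold chi2
    rw [← a]
    have b : ∀ v, 1 + (1 - 2 * p) * sgn2 (x v) = 2 * (if x v ≠ 0 then p else 1 - p) := by
      intro v; unfold sgn2
      by_cases hx : x v = 0
      · simp [hx]; ring
      · simp [hx]
    simp only [b, Finset.prod_mul_distrib, Finset.prod_const, Finset.prod_ite]
    have c : (Finset.univ.filter fun v => ¬ (x v ≠ 0)).card = n - hammingNorm x := by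
      have := Finset.card_filter_add_card_filter_not (s := (Finset.univ : Finset (Fin n))) (fun v => x v ≠ 0)
      simp only [Finset.card_univ, Fintype.card_fin] at this
      unfold hammingNorm
      omega
    rw [c]
    simp [hammingNorm]
  rw [Finset.mul_sum]
  simp only [h1]
  rw [Finset.sum_comm]
  simp only [← Finset.mul_sum]
  rw [← Finset.sum_subset (Finset.subset_univ (dual2 E)), Finset.mul_sum]
  · refine Finset.sum_le_sum fun S _ => ?_
    have h2 : |∑ x ∈ C, chi2 S x| ≤ C.card := by
      refine (Finset.abs_sum_le_sum_abs _ _).trans ?_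
      simp [chi2_abs]
    calc _ ≤ |(1 - 2 * p) ^ S.card * ∑ x ∈ C, chi2 S x| := le_abs_self _
      _ = |1 - 2 * p| ^ S.card * |∑ x ∈ C, chi2 S x| := by rw [abs_mul, abs_pow]
      _ ≤ |1 - 2 * p| ^ S.card * C.card := by gcongr
      _ = _ := mul_comm _ _
  · intro S _ hS
    rw [char_sum E S C hC hS, mul_zero]

lemma dual2_small (n d : ℕ) (hn : 0 < n) (hdpos : 0 < d) (hdodd : Odd d)
    (a : ℝ) (ha0 : 0 < a) (ha : a ≤ 1/2) (E : Finset (Finset (Fin n)))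
    (hPR : epsPR n d E (a ^ (2 * d))) (S : Finset (Fin n)) (hS : S ∈ dual2 E) :
    (S.card : ℝ) ≤ n * (a ^ d / 2) := by
  simp only [dual2, Finset.mem_filter, Finset.mem_univ, true_and] at hS
  have hn' : (0:ℝ) < n := by exact_mod_cast hn
  have hz : ∀ j, Odd j → (E.filter fun e => (e ∩ S).card = j) = ∅ := by
    intro j hj
    refine Finset.filter_eq_empty_iff.2 fun e he h => ?_
    have := hS e he
    rw [h] at this
    exact (Nat.not_even_iff_odd.2 hj) this
  have h1 := hPR S 1 hdpos
  have h2 := hPR S d le_rfl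
  rw [hz _ odd_one] at h1
  rw [hz _ hdodd] at h2
  set s : ℝ := S.card / n with hs
  have hs0 : 0 ≤ s := by positivity
  have hs1 : s ≤ 1 := by
    rw [hs, div_le_one hn']
    exact_mod_cast (Finset.card_le_univ S).trans (by simp)
  simp only [Finset.card_empty, Nat.cast_zero, zero_div, zero_sub, abs_neg, Nat.choose_self,
    Nat.cast_one, one_mul, Nat.sub_self, pow_zero, mul_one, Nat.choose_one_right, pow_one] at h1 h2
  have h2 := (le_abs_self _).trans_lt h2
  have h1 := (le_abs_self _).trans_lt h1
  rw [pow_mul] at h2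
  have hs2 : s < a ^ 2 := lt_of_pow_lt_pow_left₀ d (by positivity) h2
  have hs3 : s ≤ 1/4 := by nlinarith
  obtain ⟨m, rfl⟩ : ∃ m, d = m + 1 := ⟨d - 1, by omega⟩
  rw [Nat.add_sub_cancel] at h1
  have h3 : s * (3/4)^m ≤ a ^ (m+1) * (1/2)^(m+1) := by
    calc s * (3/4)^m ≤ s * (1 - s)^m := by gcongr; linarith
      _ ≤ ((m+1 : ℕ):ℝ) * (s * (1-s)^m) := by
          refine le_mul_of_one_le_left (mul_nonneg hs0 (pow_nonneg (by linarith) _)) ?_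
          exact_mod_cast hdpos
      _ ≤ a ^ (2 * (m+1)) := by linarith
      _ = a ^ (m+1) * a ^ (m+1) := by ring
      _ ≤ _ := by gcongr
  have h4 : s ≤ a ^ (m+1) / 2 := by
    have h5 : ((1:ℝ)/2)^m ≤ (3/4)^m := pow_le_pow_left₀ (by norm_num) (by norm_num) m
    have h6 : (0:ℝ) < (3/4)^m := by positivity
    have h7 : (0:ℝ) ≤ a^(m+1) := by positivity
    by_contra hcon
    push Not at hcon
    have := mul_lt_mul_of_pos_right hcon h6
    rw [pow_succ (1/2 : ℝ)] at h3
    nlinarith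
  have : (S.card : ℝ) = n * s := by rw [hs]; field_simp
  rw [this]
  gcongr

/-- for the span `C` of the edges of an `ε`-pseudorandom `d`-uniform (`d` odd),
`K`-regular hypergraph, in the interval `nε^{1/(2d)} ≤ i ≤ n(1−ε^{1/(2d)})` one has
`B_i/|C| ≤ n · 2^{2ε^{1/2}|n/2−i|} · C(n,i) · 2^{−n}`. -/
theorem PR_span_shell_bound (n d K : ℕ) (hn : 0 < n) (hdpos : 0 < d) (hdodd : Odd d)
    (ε : ℝ) (E : Finset (Finset (Fin n))) (hunif : ∀ e ∈ E, e.card = d)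
    (hdeg : ∀ v : Fin n, (E.filter fun e => v ∈ e).card = K)
    (hPR : epsPR n d E ε)
    (i : ℕ) (hi1 : (n : ℝ) * ε ^ ((1 : ℝ) / (2 * (d : ℝ))) ≤ (i : ℝ))
    (hi2 : (i : ℝ) ≤ (n : ℝ) * (1 - ε ^ ((1 : ℝ) / (2 * (d : ℝ))))) :
    (wtEnum ((Submodule.span (ZMod 2) (indic '' (E : Set (Finset (Fin n)))) :
          Submodule (ZMod 2) (Fin n → ZMod 2)) : Set (Fin n → ZMod 2)) i : ℝ) /
        (Nat.card (Submodule.span (ZMod 2) (indic '' (E : Set (Finset (Fin n)))) :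
          Submodule (ZMod 2) (Fin n → ZMod 2)) : ℝ) ≤
      (n : ℝ) * (2 : ℝ) ^ (2 * ε ^ ((1 : ℝ) / 2) * |(n : ℝ) / 2 - (i : ℝ)|) *
        (Nat.choose n i : ℝ) * (2 : ℝ) ^ (-(n : ℝ)) := by
  classical
  have hn' : (0:ℝ) < n := by exact_mod_cast hn
  have hd' : (0:ℝ) < d := by exact_mod_cast hdpos
  have hε : 0 < ε := (abs_nonneg _).trans_lt (hPR ∅ 0 (Nat.zero_le _))
  set a : ℝ := ε ^ ((1 : ℝ) / (2 * (d : ℝ))) with ha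
  have ha0 : 0 < a := Real.rpow_pos_of_pos hε _
  have haε : ε = a ^ (2 * d) := by
    rw [ha, ← Real.rpow_natCast, ← Real.rpow_mul hε.le]
    push_cast
    rw [one_div, inv_mul_cancel₀ (by positivity), Real.rpow_one]
  have hsq : ε ^ ((1:ℝ)/2) = a ^ d := by
    rw [ha, ← Real.rpow_natCast, ← Real.rpow_mul hε.le]
    congr 1
    field_simp
  have hah : a ≤ 1/2 := by
    have : (n:ℝ) * (2 * a) ≤ n * 1 := by linarith
    have := le_of_mul_le_mul_left this hn'
    linarith
  rw [hsq]
  have hipos : 0 < i := by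
    have : (0:ℝ) < i := lt_of_lt_of_le (by positivity) hi1
    exact_mod_cast this
  have hin : i < n := by
    have : (i:ℝ) < n := lt_of_le_of_lt hi2 (by nlinarith)
    exact_mod_cast this
  rw [haε] at hPR
  clear_value a
  set p : ℝ := i / n with hp
  have hp0 : 0 < p := by positivity
  have hp1 : p < 1 := by rw [hp, div_lt_one hn']; exact_mod_cast hin
  set W := Submodule.span (ZMod 2) (indic '' (E : Set (Finset (Fin n)))) with hW
  set C : Finset (Fin n → ZMod 2) := Finset.univ.filter (fun x => x ∈ W) with hCdef
  have hC : ∀ x, x ∈ C ↔ x ∈ W := by intro x; simp [hCdef]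
  have hcard : (Nat.card W : ℝ) = C.card := by
    norm_cast
    rw [Nat.card_eq_fintype_card]
    exact Fintype.card_of_subtype C hC
  have hCpos : (0:ℝ) < C.card := by
    have : 0 < C.card := Finset.card_pos.2 ⟨0, (hC 0).2 W.zero_mem⟩
    exact_mod_cast this
  have hwt : wtEnum (W : Set (Fin n → ZMod 2)) i = (C.filter fun x => hammingNorm x = i).card := by
    unfold wtEnum
    rw [← Set.ncard_coe_finset]
    congr 1
    ext x; simp [hC]
  rw [hcard, hwt]
  set B := (C.filter fun x => hammingNorm x = i).card with hB
  have hq0 : 0 < 1 - p := by linarith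
  have hmac := macw E p C hC
  have hBle : B * (p ^ i * (1-p)^(n-i)) ≤
      ∑ x ∈ C, p ^ (hammingNorm x) * (1 - p) ^ (n - hammingNorm x) := by
    calc (B:ℝ) * (p ^ i * (1-p)^(n-i)) = ∑ x ∈ C.filter (fun x => hammingNorm x = i),
          p ^ (hammingNorm x) * (1 - p) ^ (n - hammingNorm x) := by
          rw [Finset.sum_congr rfl (g := fun _ => p ^ i * (1-p)^(n-i))]
          · simp [hB]
          · intro x hx; rw [(Finset.mem_filter.1 hx).2]
      _ ≤ _ := Finset.sum_le_sum_of_subset_of_nonneg (Finset.filter_subset _ _)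
          fun _ _ _ => by positivity
  set t := |1 - 2 * p| with ht
  have ht0 : 0 ≤ t := abs_nonneg _
  have ht1 : t ≤ 1 := by rw [ht, abs_le]; constructor <;> linarith
  obtain ⟨Y, hY, hsum⟩ := dual2_sum E t ht0 ht1
  have hYc := dual2_small n d hn hdpos hdodd a ha0 hah E hPR Y hY
  set R : ℝ := (2 : ℝ) ^ (2 * a ^ d * |(n : ℝ) / 2 - (i : ℝ)|) with hR
  have hpow : (1 + t) ^ Y.card ≤ R := by
    have hnt : 2 * |(n : ℝ) / 2 - (i : ℝ)| = n * t := by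
      rw [ht, ← abs_of_pos hn', ← abs_mul, abs_of_pos hn', ← abs_of_pos (two_pos : (0:ℝ) < 2),
        ← abs_mul, abs_of_pos (two_pos : (0:ℝ) < 2)]
      congr 1
      rw [hp]; field_simp
    calc (1 + t) ^ Y.card ≤ (Real.exp t) ^ Y.card := by
          gcongr; linarith [Real.add_one_le_exp t]
      _ = Real.exp (Y.card * t) := (Real.exp_nat_mul t _).symm
      _ ≤ Real.exp (Real.log 2 * (2 * a ^ d * |(n : ℝ) / 2 - (i : ℝ)|)) := by
          apply Real.exp_le_exp.2
          have hl : (1:ℝ)/2 ≤ Real.log 2 := by linarith [Real.log_two_gt_d9]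
          have hx : (0:ℝ) ≤ a ^ d * (n * t) := by positivity
          calc (Y.card:ℝ) * t ≤ n * (a^d/2) * t := by gcongr
            _ = 1/2 * (a ^ d * (n * t)) := by ring
            _ ≤ Real.log 2 * (a ^ d * (n * t)) := by gcongr
            _ = _ := by rw [← hnt]; ring
      _ = R := by rw [hR, Real.rpow_def_of_pos two_pos]
  have hbin : 1 ≤ n * (n.choose i * (p ^ i * (1-p)^(n-i))) := by
    obtain ⟨k, rfl⟩ : ∃ k, n = i + k := ⟨n - i, by omega⟩
    have h := aux_binmax i k hipos (by omega)
    have h' : (((i+k : ℕ):ℝ))^(i+k) ≤ ((i+k : ℕ):ℝ) * (((i+k).choose i : ℕ) * (i:ℝ)^i * (k:ℝ)^k) := by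
      exact_mod_cast h
    rw [Nat.add_sub_cancel_left]
    have hq : 1 - p = k / ((i+k : ℕ):ℝ) := by
      rw [hp]; field_simp; push_cast; ring
    rw [hq, hp, div_pow, div_pow, div_mul_div_comm, ← pow_add, ← mul_div_assoc, ← mul_div_assoc,
      one_le_div (by positivity)]
    linarith
  have h2n : (2:ℝ) ^ (-(n:ℝ)) = (2 ^ n)⁻¹ := by
    rw [Real.rpow_neg two_pos.le, Real.rpow_natCast]
  rw [h2n, div_le_iff₀ hCpos, ← div_eq_mul_inv, div_mul_eq_mul_div, le_div_iff₀ (by positivity)]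
  set P := p ^ i * (1-p)^(n-i) with hP
  have hP0 : 0 < P := by positivity
  have hfin : 2 ^ n * (B * P) ≤ C.card * R := by
    calc 2 ^ n * (B * P) ≤ _ := mul_le_mul_of_nonneg_left hBle (by positivity)
      _ ≤ _ := hmac
      _ ≤ C.card * R := mul_le_mul_of_nonneg_left (hsum.trans hpow) hCpos.le
  calc (B:ℝ) * 2 ^ n = (B * 2^n) * 1 := by ring
    _ ≤ (B * 2^n) * (n * (n.choose i * P)) :=
        mul_le_mul_of_nonneg_left hbin (mul_nonneg (Nat.cast_nonneg _) (pow_nonneg two_pos.le _))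
    _ = (n * n.choose i) * (2 ^ n * (B * P)) := by ring
    _ ≤ (n * n.choose i) * (C.card * R) :=
        mul_le_mul_of_nonneg_left hfin (mul_nonneg (Nat.cast_nonneg _) (Nat.cast_nonneg _))
    _ = _ := by ring
end

section
/- Fix a positive integer n. For every m ∈ {0,…,⌊n/2⌋} and every integer x ∈ {0,…,n}, the Kravchuk polynomials satisfy (P_m(x))^2 = Σ_{i=0}^{m} C(2i,i)·C(n−2i,m−i)·P_{2i}(x). -/
open Finset

lemma genChoose_nat (x l : ℕ) : genChoose (x : ℝ) l = (x.choose l : ℝ) := by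
  unfold genChoose
  rw [Nat.cast_choose_eq_ascPochhammer_div, ← descPochhammer_eval_eq_prod_range]
  congr 1
  rw [descPochhammer_eval_eq_descFactorial, Nat.cast_descFactorial]

lemma coeff_lin_pow {S : Type*} [CommRing S] (U V : S) (a k : ℕ) :
    ((Polynomial.C U + Polynomial.C V * Polynomial.X) ^ a).coeff k =
      (a.choose k : S) * V ^ k * U ^ (a - k) := by
  have h : (Polynomial.C U + Polynomial.C V * Polynomial.X) ^ a =
      ∑ j ∈ range (a + 1),
        Polynomial.C ((a.choose j : S) * V ^ j * U ^ (a - j)) * Polynomial.X ^ j := by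
    rw [add_comm, add_pow]
    refine Finset.sum_congr rfl fun j _ => ?_
    simp only [map_mul, map_pow, map_natCast]
    ring
  rw [h, Polynomial.finsetSum_coeff]
  simp only [Polynomial.coeff_C_mul_X_pow]
  rw [Finset.sum_ite_eq]
  split_ifs with hk
  · rfl
  · rw [Nat.choose_eq_zero_of_lt (by simpa using hk)]; simp

lemma krav_nat (n m x : ℕ) (hx : x ≤ n) : krav n m (x : ℝ) =
    ∑ p ∈ antidiagonal m, (-1 : ℝ) ^ p.1 * (x.choose p.1 : ℝ) * ((n - x).choose p.2 : ℝ) := by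
  rw [Finset.Nat.sum_antidiagonal_eq_sum_range_succ_mk]
  unfold krav
  refine Finset.sum_congr rfl fun l _ => ?_
  rw [← Nat.cast_sub hx, genChoose_nat, genChoose_nat]

lemma hom_coeff {S : Type*} [CommRing S] [Algebra ℝ S] (U V : S) (n k x : ℕ) (hx : x ≤ n) :
    ((Polynomial.C U + Polynomial.C (-V) * Polynomial.X) ^ x *
      (Polynomial.C U + Polynomial.C V * Polynomial.X) ^ (n - x)).coeff k =
      algebraMap ℝ S (krav n k (x : ℝ)) * V ^ k * U ^ (n - k) := by
  rw [Polynomial.coeff_mul, krav_nat n k x hx, map_sum, Finset.sum_mul, Finset.sum_mul]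
  refine Finset.sum_congr rfl fun p hp => ?_
  rw [coeff_lin_pow, coeff_lin_pow]
  obtain ⟨l, j⟩ := p
  simp only [HasAntidiagonal.mem_antidiagonal] at hp
  simp only [map_mul, map_pow, map_neg, map_one, map_natCast]
  by_cases h1 : x < l
  · simp [Nat.choose_eq_zero_of_lt h1]
  by_cases h2 : n - x < j
  · simp [Nat.choose_eq_zero_of_lt h2]
  have e : n - k = (x - l) + (n - x - j) := by omega
  rw [e, ← hp, pow_add, pow_add, neg_pow V]
  ring

lemma hom_sum {S : Type*} [CommRing S] [Algebra ℝ S] (U V : S) (n x : ℕ) (hx : x ≤ n) :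
    (U - V) ^ x * (U + V) ^ (n - x) =
      ∑ k ∈ range (n + 1), algebraMap ℝ S (krav n k (x : ℝ)) * V ^ k * U ^ (n - k) := by
  have hl : ∀ W : S, (Polynomial.C U + Polynomial.C W * Polynomial.X).natDegree ≤ 1 := by
    intro W
    compute_degree
  have hd : ((Polynomial.C U + Polynomial.C (-V) * Polynomial.X) ^ x *
      (Polynomial.C U + Polynomial.C V * Polynomial.X) ^ (n - x)).natDegree < n + 1 := by
    have h1 := Polynomial.natDegree_pow_le_of_le x (hl (-V))
    have h2 := Polynomial.natDegree_pow_le_of_le (n - x) (hl V)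
    have := Polynomial.natDegree_mul_le_of_le h1 h2
    omega
  have := Polynomial.eval_eq_sum_range' hd 1
  simp only [hom_coeff U V n _ x hx, one_pow, mul_one] at this
  rw [← this]
  simp [sub_eq_add_neg]

lemma coeff_mid (n m k : ℕ) (hk : k ≤ n) :
    (((((Polynomial.C Polynomial.X + Polynomial.X : Polynomial (Polynomial ℝ)) ^ k *
      (1 + Polynomial.C Polynomial.X * Polynomial.X) ^ (n - k))).coeff m).coeff m) =
    if k % 2 = 0 ∧ k / 2 ≤ m then
      (k.choose (k / 2) : ℝ) * ((n - k).choose (m - k / 2) : ℝ) else 0 := by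
  have h1 := coeff_lin_pow (S := Polynomial ℝ) Polynomial.X 1 k
  have h2 := coeff_lin_pow (S := Polynomial ℝ) 1 Polynomial.X (n - k)
  simp only [map_one, one_mul, one_pow, mul_one] at h1 h2
  rw [Polynomial.coeff_mul, Polynomial.finsetSum_coeff]
  have h3 : ∀ p ∈ antidiagonal m, ((((Polynomial.C Polynomial.X + Polynomial.X :
      Polynomial (Polynomial ℝ)) ^ k).coeff p.1 *
      ((1 + Polynomial.C Polynomial.X * Polynomial.X) ^ (n - k)).coeff p.2).coeff m : ℝ) =
      if p = (k / 2, m - k / 2) then (if k % 2 = 0 ∧ k / 2 ≤ m then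
      (k.choose (k / 2) : ℝ) * ((n - k).choose (m - k / 2) : ℝ) else 0) else 0 := by
    rintro ⟨j, l⟩ hp
    simp only [HasAntidiagonal.mem_antidiagonal] at hp
    rw [h1, h2]
    have e : ((k.choose j : Polynomial ℝ) * Polynomial.X ^ (k - j) *
        (((n - k).choose l : Polynomial ℝ) * Polynomial.X ^ l)) =
        Polynomial.C ((k.choose j : ℝ) * ((n - k).choose l : ℝ)) *
          Polynomial.X ^ (k - j + l) := by
      simp only [map_mul, map_natCast]
      ring
    simp only [e, Polynomial.coeff_C_mul_X_pow, Prod.mk.injEq]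
    by_cases hj : k < j
    · rw [Nat.choose_eq_zero_of_lt hj]
      rw [if_neg (show ¬ (j = k / 2 ∧ l = m - k / 2) by omega)]
      simp
    by_cases hm : m = k - j + l
    · have a : j = k / 2 := by omega
      have b : l = m - k / 2 := by omega
      rw [if_pos hm, if_pos ⟨a, b⟩, if_pos (by omega), ← a, show m - j = l by omega]
    · rw [if_neg hm]
      split_ifs <;> first | rfl | omega
  rw [Finset.sum_congr rfl h3, Finset.sum_ite_eq']
  by_cases h : k % 2 = 0 ∧ k / 2 ≤ m
  · rw [if_pos]
    simp only [HasAntidiagonal.mem_antidiagonal]; omega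
  · simp [h]

lemma krav_coeff (n m x : ℕ) (hx : x ≤ n) :
    (((1 - Polynomial.X) ^ x * (1 + Polynomial.X) ^ (n - x) : Polynomial ℝ)).coeff m =
      krav n m (x : ℝ) := by
  have := hom_coeff (S := ℝ) 1 1 n m x hx
  simpa [sub_eq_add_neg] using this

/-- `(P_m(x))² = Σ_{i=0}^m C(2i,i) C(n−2i,m−i) P_{2i}(x)` for integer `0 ≤ x ≤ n`
and `0 ≤ m ≤ ⌊n/2⌋`. -/
theorem krav_sq_decomposition (n : ℕ) (hn : 0 < n) (m : ℕ) (hm : m ≤ n / 2)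
    (x : ℕ) (hx : x ≤ n) :
    (krav n m (x : ℝ)) ^ 2 =
      ∑ i ∈ Finset.range (m + 1),
        (Nat.choose (2 * i) i : ℝ) * (Nat.choose (n - 2 * i) (m - i) : ℝ) *
          krav n (2 * i) (x : ℝ) := by
  set f : Polynomial ℝ := (1 - Polynomial.X) ^ x * (1 + Polynomial.X) ^ (n - x) with hf
  have key : (Polynomial.C f * f.map Polynomial.C : Polynomial (Polynomial ℝ)) =
      ∑ k ∈ range (n + 1), algebraMap ℝ (Polynomial (Polynomial ℝ)) (krav n k (x : ℝ)) *
        (Polynomial.C Polynomial.X + Polynomial.X) ^ k *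
        (1 + Polynomial.C Polynomial.X * Polynomial.X) ^ (n - k) := by
    rw [← hom_sum _ _ n x hx]
    simp only [hf, map_mul, map_pow, map_sub, map_add, map_one, Polynomial.map_mul,
      Polynomial.map_pow, Polynomial.map_sub, Polynomial.map_add, Polynomial.map_one,
      Polynomial.map_X]
    rw [mul_mul_mul_comm, ← mul_pow, ← mul_pow]
    congr 2 <;> ring
  have h2 := congrArg (fun p => (p.coeff m).coeff m) key
  simp only [Polynomial.coeff_C_mul, Polynomial.coeff_map, Polynomial.coeff_mul_C,
    Polynomial.finsetSum_coeff, mul_assoc] at h2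
  rw [hf, krav_coeff n m x hx] at h2
  rw [sq, h2]
  have h3 : ∀ k ∈ range (n + 1), ((algebraMap ℝ (Polynomial (Polynomial ℝ)) (krav n k (x : ℝ)) *
        ((Polynomial.C Polynomial.X + Polynomial.X) ^ k *
        (1 + Polynomial.C Polynomial.X * Polynomial.X) ^ (n - k))).coeff m).coeff m =
      if k % 2 = 0 ∧ k / 2 ≤ m then
      (k.choose (k / 2) : ℝ) * ((n - k).choose (m - k / 2) : ℝ) * krav n k (x : ℝ) else 0 := by
    intro k hk
    rw [← Algebra.smul_def, Polynomial.coeff_smul, Polynomial.coeff_smul,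
      coeff_mid n m k (by simpa [Nat.lt_succ_iff] using hk), smul_eq_mul]
    split_ifs <;> ring
  rw [Finset.sum_congr rfl h3, ← Finset.sum_filter]
  refine Finset.sum_nbij' (fun k => k / 2) (fun i => 2 * i) ?_ ?_ ?_ ?_ ?_
  · intro k hk; simp only [mem_filter, mem_range] at hk ⊢; omega
  · intro k hk; simp only [mem_filter, mem_range] at hk ⊢; omega
  · intro k hk; simp only [mem_filter, mem_range] at hk ⊢; omega
  · intro k hk; simp only [mem_range] at hk ⊢; omega
  · intro k hk
    simp only [mem_filter, mem_range] at hk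
    rw [show 2 * (k / 2) = k by omega]
end

section
/- Fix a positive integer n and let g be a real polynomial of degree at most n. Define g_j := (1/(2^n·C(n,j)))·Σ_{k=0}^n C(n,k)·P_j(k)·g(k) for j ∈ {0,…,n}. Then g(x) = Σ_{j=0}^n g_j·P_j(x) as polynomials (in particular the identity holds for every real x). -/
open Finset

open Polynomial in
lemma kd_genChoose_nat (k l : ℕ) : genChoose (k : ℝ) l = (k.choose l : ℝ) := by
  unfold genChoose
  rw [← descPochhammer_eval_eq_prod_range, descPochhammer_eval_eq_descFactorial,
    Nat.descFactorial_eq_factorial_mul_choose]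
  have : (l.factorial : ℝ) ≠ 0 := by positivity
  push_cast
  field_simp

lemma kd_krav_nat (n m k : ℕ) (hk : k ≤ n) : krav n m (k : ℝ) =
    ∑ l ∈ Finset.range (m + 1), (-1 : ℝ) ^ l * (k.choose l : ℝ) * ((n - k).choose (m - l) : ℝ) := by
  unfold krav
  rw [← Nat.cast_sub hk]
  simp only [kd_genChoose_nat]

lemma kd_coeff_sub (k l : ℕ) :
    ((1 - Polynomial.X : Polynomial ℝ) ^ k).coeff l = (-1) ^ l * (k.choose l : ℝ) := by
  have h : (1 - Polynomial.X : Polynomial ℝ) ^ k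
      = ((1 + Polynomial.X : Polynomial ℝ) ^ k).comp (Polynomial.C (-1) * Polynomial.X) := by
    simp [sub_eq_add_neg]
  rw [h, Polynomial.comp_C_mul_X_coeff, Polynomial.coeff_one_add_X_pow, mul_comm]

lemma kd_krav_coeff (n m k : ℕ) (hk : k ≤ n) : krav n m (k : ℝ) =
    ((1 - Polynomial.X : Polynomial ℝ) ^ k * (1 + Polynomial.X) ^ (n - k)).coeff m := by
  rw [kd_krav_nat n m k hk, Polynomial.coeff_mul, Finset.Nat.sum_antidiagonal_eq_sum_range_succ_mk]
  simp only [kd_coeff_sub, Polynomial.coeff_one_add_X_pow]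

lemma kd_choose (N a b : ℕ) : N.choose a * (N - a).choose b = N.choose b * (N - b).choose a := by
  by_cases h : a + b ≤ N
  · have e1 := Nat.choose_mul_factorial_mul_factorial (show a ≤ N by omega)
    have e2 := Nat.choose_mul_factorial_mul_factorial (show b ≤ N - a by omega)
    have e3 := Nat.choose_mul_factorial_mul_factorial (show b ≤ N by omega)
    have e4 := Nat.choose_mul_factorial_mul_factorial (show a ≤ N - b by omega)
    have e5 : N - b - a = N - a - b := by omega
    rw [e5] at e4
    have hp : 0 < a.factorial * b.factorial * (N - a - b).factorial := by positivity
    apply Nat.eq_of_mul_eq_mul_right hp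
    rw [← e2] at e1
    rw [← e4] at e3
    linarith
  · have h1 : N.choose a * (N - a).choose b = 0 := by
      by_cases ha : N < a
      · simp [Nat.choose_eq_zero_of_lt ha]
      · rw [Nat.choose_eq_zero_of_lt (show N - a < b by omega), mul_zero]
    have h2 : N.choose b * (N - b).choose a = 0 := by
      by_cases ha : N < b
      · simp [Nat.choose_eq_zero_of_lt ha]
      · rw [Nat.choose_eq_zero_of_lt (show N - b < a by omega), mul_zero]
    rw [h1, h2]

lemma kd_choose3 (n k j l : ℕ) (hk : k ≤ n) (hj : j ≤ n) (hlk : l ≤ k) (hlj : l ≤ j) :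
    n.choose k * k.choose l * (n - k).choose (j - l)
      = n.choose j * j.choose l * (n - j).choose (k - l) := by
  rw [Nat.choose_mul hlk, Nat.choose_mul hlj]
  have := kd_choose (n - l) (k - l) (j - l)
  rw [show n - l - (k - l) = n - k by omega, show n - l - (j - l) = n - j by omega] at this
  rw [mul_assoc, this, mul_assoc]

lemma kd_krav_min (n m k : ℕ) (hk : k ≤ n) (hm : m ≤ n) : krav n m (k : ℝ) =
    ∑ l ∈ Finset.range (n + 1), if l ≤ k ∧ l ≤ m then
      (-1 : ℝ) ^ l * (k.choose l : ℝ) * ((n - k).choose (m - l) : ℝ) else 0 := by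
  rw [kd_krav_nat n m k hk]
  rw [← Finset.sum_subset (Finset.range_mono (show m + 1 ≤ n + 1 by omega))]
  · apply Finset.sum_congr rfl
    intro l hl
    simp only [Finset.mem_range] at hl
    split_ifs with h
    · rfl
    · rw [Nat.choose_eq_zero_of_lt (show k < l by omega)]; simp
  · intro l _ hl
    simp only [Finset.mem_range] at hl
    rw [if_neg (by omega)]

lemma kd_symm (n k j : ℕ) (hk : k ≤ n) (hj : j ≤ n) :
    (n.choose k : ℝ) * krav n j (k : ℝ) = (n.choose j : ℝ) * krav n k (j : ℝ) := by
  rw [kd_krav_min n j k hk hj, kd_krav_min n k j hj hk, Finset.mul_sum, Finset.mul_sum]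
  apply Finset.sum_congr rfl
  intro l _
  by_cases h : l ≤ k ∧ l ≤ j
  · rw [if_pos h, if_pos h.symm]
    have := kd_choose3 n k j l hk hj h.1 h.2
    have h' : (n.choose k * k.choose l * (n - k).choose (j - l) : ℝ)
      = n.choose j * j.choose l * (n - j).choose (k - l) := by exact_mod_cast this
    linear_combination (-1 : ℝ) ^ l * h'
  · rw [if_neg h, if_neg (fun h' => h h'.symm)]
    simp

lemma kd_hom_step (n : ℕ) (p A B : Polynomial ℝ) (s : ℝ) (hp : p.natDegree ≤ n) :
    ∑ j ∈ Finset.range (n + 1 + 1),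
        Polynomial.C ((p * (1 + Polynomial.C s * Polynomial.X)).coeff j) * A ^ j * B ^ (n + 1 - j)
      = (∑ j ∈ Finset.range (n + 1), Polynomial.C (p.coeff j) * A ^ j * B ^ (n - j))
        * (B + Polynomial.C s * A) := by
  have e : p * (1 + Polynomial.C s * Polynomial.X) = p + Polynomial.C s * p * Polynomial.X := by ring
  have e1 : ∑ j ∈ Finset.range (n + 1 + 1), Polynomial.C (p.coeff j) * A ^ j * B ^ (n + 1 - j)
      = (∑ j ∈ Finset.range (n + 1), Polynomial.C (p.coeff j) * A ^ j * B ^ (n - j)) * B := by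
    rw [Finset.sum_range_succ, Polynomial.coeff_eq_zero_of_natDegree_lt (show p.natDegree < n + 1 by omega),
      Finset.sum_mul]
    simp only [Polynomial.C_0, zero_mul, add_zero]
    apply Finset.sum_congr rfl
    intro j hj
    simp only [Finset.mem_range] at hj
    rw [show n + 1 - j = n - j + 1 by omega]
    ring
  have e2 : ∑ j ∈ Finset.range (n + 1 + 1),
      Polynomial.C ((Polynomial.C s * p * Polynomial.X).coeff j) * A ^ j * B ^ (n + 1 - j)
      = (∑ j ∈ Finset.range (n + 1), Polynomial.C (p.coeff j) * A ^ j * B ^ (n - j))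
        * (Polynomial.C s * A) := by
    rw [Finset.sum_range_succ', Finset.sum_mul]
    simp only [Polynomial.coeff_mul_X, Polynomial.mul_coeff_zero, Polynomial.coeff_X_zero, mul_zero,
      Polynomial.C_0, zero_mul, add_zero, Polynomial.coeff_C_mul, Polynomial.C_mul]
    apply Finset.sum_congr rfl
    intro j hj
    rw [show n + 1 - (j + 1) = n - j by omega]
    ring
  rw [e, mul_add, ← e1, ← e2, ← Finset.sum_add_distrib]
  apply Finset.sum_congr rfl
  intro j _
  rw [Polynomial.coeff_add, Polynomial.C_add]
  ring

lemma kd_deg (a b : ℕ) :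
    ((1 - Polynomial.X : Polynomial ℝ) ^ a * (1 + Polynomial.X) ^ b).natDegree ≤ a + b := by
  compute_degree

lemma kd_hom (A B : Polynomial ℝ) (a b : ℕ) :
    ∑ j ∈ Finset.range (a + b + 1),
        Polynomial.C (((1 - Polynomial.X : Polynomial ℝ) ^ a * (1 + Polynomial.X) ^ b).coeff j)
          * A ^ j * B ^ (a + b - j)
      = (B - A) ^ a * (B + A) ^ b := by
  induction b with
  | zero =>
    induction a with
    | zero => simp
    | succ a ih =>
      have h := kd_hom_step a ((1 - Polynomial.X : Polynomial ℝ) ^ a * (1 + Polynomial.X) ^ 0)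
        A B (-1) (kd_deg a 0)
      have e : (1 - Polynomial.X : Polynomial ℝ) ^ (a + 1) * (1 + Polynomial.X) ^ 0
        = (1 - Polynomial.X : Polynomial ℝ) ^ a * (1 + Polynomial.X) ^ 0 *
          (1 + Polynomial.C (-1) * Polynomial.X) := by
        simp only [Polynomial.C_neg, Polynomial.C_1]; ring
      rw [e]
      simp only [add_zero] at ih ⊢
      rw [h, ih]
      simp only [Polynomial.C_neg, Polynomial.C_1]; ring
  | succ b ih =>
      have h := kd_hom_step (a + b) ((1 - Polynomial.X : Polynomial ℝ) ^ a * (1 + Polynomial.X) ^ b)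
        A B 1 (kd_deg a b)
      have e : (1 - Polynomial.X : Polynomial ℝ) ^ a * (1 + Polynomial.X) ^ (b + 1)
        = (1 - Polynomial.X : Polynomial ℝ) ^ a * (1 + Polynomial.X) ^ b *
          (1 + Polynomial.C 1 * Polynomial.X) := by
        simp only [Polynomial.C_1]; ring
      rw [e, ← add_assoc, h, ih]
      simp only [Polynomial.C_1]; ring

lemma kd_orth (n i k : ℕ) (hi : i ≤ n) :
    ∑ j ∈ Finset.range (n + 1), krav n j (i : ℝ) * krav n k (j : ℝ)
      = if k = i then (2 : ℝ) ^ n else 0 := by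
  have h := kd_hom (1 - Polynomial.X) (1 + Polynomial.X) i (n - i)
  rw [show i + (n - i) = n by omega] at h
  have e : ((1 + Polynomial.X : Polynomial ℝ) - (1 - Polynomial.X)) ^ i
      * ((1 + Polynomial.X) + (1 - Polynomial.X)) ^ (n - i)
      = Polynomial.C ((2 : ℝ) ^ n) * Polynomial.X ^ i := by
    rw [show ((1 + Polynomial.X : Polynomial ℝ) - (1 - Polynomial.X)) = 2 * Polynomial.X by ring,
      show ((1 + Polynomial.X : Polynomial ℝ) + (1 - Polynomial.X)) = 2 by ring, mul_pow,
      mul_right_comm, ← pow_add, show i + (n - i) = n by omega]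
    rw [Polynomial.C_pow, Polynomial.C_ofNat]
  rw [e] at h
  have h2 := congrArg (fun p => Polynomial.coeff p k) h
  simp only [Polynomial.finsetSum_coeff, Polynomial.coeff_C_mul, Polynomial.coeff_X_pow, mul_assoc]
    at h2
  rw [mul_ite, mul_one, mul_zero] at h2
  rw [← h2]
  apply Finset.sum_congr rfl
  intro j hj
  simp only [Finset.mem_range] at hj
  rw [kd_krav_coeff n j i hi, kd_krav_coeff n k j (by omega)]

lemma kd_genChoose_poly (q : Polynomial ℝ) (hq : q.natDegree ≤ 1) (l : ℕ) :
    ∃ p : Polynomial ℝ, p.natDegree ≤ l ∧ ∀ x, p.eval x = genChoose (q.eval x) l := by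
  refine ⟨Polynomial.C ((l.factorial : ℝ)⁻¹) * (descPochhammer ℝ l).comp q, ?_, ?_⟩
  · refine (Polynomial.natDegree_C_mul_le _ _).trans ?_
    refine Polynomial.natDegree_comp_le.trans ?_
    rw [descPochhammer_natDegree]
    nlinarith
  · intro x
    rw [Polynomial.eval_mul, Polynomial.eval_C, Polynomial.eval_comp,
      descPochhammer_eval_eq_prod_range, genChoose]
    ring

lemma kd_krav_poly (n m : ℕ) :
    ∃ p : Polynomial ℝ, p.natDegree ≤ m ∧ ∀ x, p.eval x = krav n m x := by
  choose f hf hf' using kd_genChoose_poly Polynomial.X (by compute_degree)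
  choose u hu hu' using kd_genChoose_poly (Polynomial.C (n : ℝ) - Polynomial.X) (by compute_degree)
  refine ⟨∑ l ∈ Finset.range (m + 1), Polynomial.C ((-1 : ℝ) ^ l) * f l * u (m - l), ?_, ?_⟩
  · apply Polynomial.natDegree_sum_le_of_forall_le
    intro l hl
    simp only [Finset.mem_range] at hl
    have h1 := hf l
    have h2 := hu (m - l)
    have h3 := Polynomial.natDegree_C_mul_le ((-1 : ℝ) ^ l) (f l)
    refine Polynomial.natDegree_mul_le.trans ?_
    omega
  · intro x
    rw [Polynomial.eval_finsetSum]
    simp [hf', hu', krav]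

/-- Kravchuk decomposition of a polynomial `g` of degree at most `n`. -/
theorem krav_decomposition (n : ℕ) (hn : 0 < n) (g : Polynomial ℝ) (hg : g.natDegree ≤ n) :
    ∀ x : ℝ, g.eval x =
      ∑ j ∈ Finset.range (n + 1),
        (1 / ((2 : ℝ) ^ n * (Nat.choose n j : ℝ)) *
          ∑ k ∈ Finset.range (n + 1),
            (Nat.choose n k : ℝ) * krav n j (k : ℝ) * g.eval (k : ℝ)) * krav n j x := by
  choose P hP hP' using kd_krav_poly n
  set c : ℕ → ℝ := fun j => (1 / ((2 : ℝ) ^ n * (Nat.choose n j : ℝ)) *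
          ∑ k ∈ Finset.range (n + 1),
            (Nat.choose n k : ℝ) * krav n j (k : ℝ) * g.eval (k : ℝ)) with hc
  have hc' : ∀ j ∈ Finset.range (n + 1), c j = ∑ k ∈ Finset.range (n + 1),
      (1 / (2 : ℝ) ^ n) * g.eval (k : ℝ) * krav n k (j : ℝ) := by
    intro j hj
    simp only [Finset.mem_range] at hj
    rw [hc]
    simp only []
    rw [Finset.mul_sum]
    apply Finset.sum_congr rfl
    intro k hk
    simp only [Finset.mem_range] at hk
    rw [kd_symm n k j (by omega) (by omega)]
    have : (n.choose j : ℝ) ≠ 0 := by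
      exact_mod_cast (Nat.choose_pos (show j ≤ n by omega)).ne'
    field_simp
  have key : g = ∑ j ∈ Finset.range (n + 1), Polynomial.C (c j) * P j := by
    apply Polynomial.eq_of_natDegree_lt_card_of_eval_eq' _ _
      ((Finset.range (n + 1)).image (fun i : ℕ => (i : ℝ)))
    · intro y hy
      simp only [Finset.mem_image, Finset.mem_range] at hy
      obtain ⟨i, hi, rfl⟩ := hy
      rw [Polynomial.eval_finsetSum]
      simp only [Polynomial.eval_mul, Polynomial.eval_C, hP']
      rw [Finset.sum_congr rfl (fun j hj => by rw [hc' j hj, Finset.sum_mul]), Finset.sum_comm]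
      have : ∀ k ∈ Finset.range (n + 1), ∑ j ∈ Finset.range (n + 1),
          (1 / (2 : ℝ) ^ n) * g.eval (k : ℝ) * krav n k (j : ℝ) * krav n j (i : ℝ)
          = if k = i then g.eval (k : ℝ) else 0 := by
        intro k _
        have h := kd_orth n i k (by omega)
        rw [Finset.sum_congr rfl (fun j _ => by
          rw [mul_assoc, mul_comm (krav n k (j : ℝ))]), ← Finset.mul_sum, h]
        split_ifs
        · field_simp
        · simp
      rw [Finset.sum_congr rfl this, Finset.sum_ite_eq']
      simp [hi]
    · rw [Finset.card_image_of_injective _ Nat.cast_injective, Finset.card_range]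
      refine Nat.lt_succ_of_le (max_le hg ?_)
      apply Polynomial.natDegree_sum_le_of_forall_le
      intro j hj
      simp only [Finset.mem_range] at hj
      exact (Polynomial.natDegree_C_mul_le _ _).trans ((hP j).trans (by omega))
  intro x
  conv_lhs => rw [key]
  rw [Polynomial.eval_finsetSum]
  simp only [Polynomial.eval_mul, Polynomial.eval_C, hP']
  rfl
end
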